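/- arXiv:2412.20700 — 7 statements merged into one kernel-verified Lean document; each statement's English description precedes it below -/
import Mathlib

section
/- Fix an integer n ≥ 1. The algorithm optimal_uniform(n) terminates with probability 1 and its output is uniform over {1, …, n}: the stopping time T is finite μ-almost surely, and for every i with 1 ≤ i ≤ n, μ({b : T(b) < ∞ and X_{T(b)}(b) = i}) = 1/n. -/
open MeasureTheory
open scoped ENNReal NNReal

/-- One step of the `optimal_uniform n` algorithm: from state `(X, m)`, driven by a
fair coin flip `B`.  The state with `m = n` is absorbing. -/
def kyStep (n : ℕ) (s : ℕ × ℕ) (B : Bool) : ℕ × ℕ :=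
  if s.2 = n then s
  else
    let X' := s.1 + (if B then s.2 else 0)
    let m' := 2 * s.2
    if n ≤ m' then (if X' ≤ n then (X', n) else (X' - n, m' - n)) else (X', m')

/-- The state `(X_k b, m_k b)` after `k` coin flips, starting from `(1, 1)`. -/
def kyState (n : ℕ) (b : ℕ → Bool) : ℕ → ℕ × ℕ
  | 0 => (1, 1)
  | k + 1 => kyStep n (kyState n b k) (b k)

/-- The number of flips used by `optimal_uniform n`: the first time `m_k = n`
(`⊤` if the algorithm never terminates). -/
noncomputable def kyT (n : ℕ) (b : ℕ → Bool) : ℕ∞ :=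
  ⨅ (k : ℕ) (_ : (kyState n b k).2 = n), (k : ℕ∞)

open Filter Topology

/-- The number of bit strings of length `k` that lead from the state `s` to the state `t`. -/
def kyCount (n : ℕ) (t : ℕ × ℕ) : ℕ → ℕ × ℕ → ℕ
  | 0, s => if s = t then 1 else 0
  | k + 1, s => kyCount n t k (kyStep n s true) + kyCount n t k (kyStep n s false)

theorem kyStep_of_absorbing (n x : ℕ) (B : Bool) : kyStep n (x, n) B = (x, n) := by
  simp [kyStep]

theorem kyCount_of_absorbing (n : ℕ) (t : ℕ × ℕ) (k x : ℕ) :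
    kyCount n t k (x, n) = if (x, n) = t then 2 ^ k else 0 := by
  induction k with
  | zero => simp [kyCount]
  | succ k ih =>
    simp only [kyCount, kyStep_of_absorbing, ih]
    split_ifs <;> ring

theorem sum_kyCount_of_absorbing {n i : ℕ} (hi : 1 ≤ i) (hin : i ≤ n) (k : ℕ) :
    ∑ x ∈ Finset.range n, kyCount n (i, n) k (x + 1, n) = 2 ^ k := by
  rw [Finset.sum_eq_single (i - 1)]
  · rw [Nat.sub_add_cancel hi, kyCount_of_absorbing, if_pos rfl]
  · intro x _ hx
    rw [kyCount_of_absorbing, if_neg]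
    rw [Prod.mk.injEq]
    omega
  · intro h
    rw [Finset.mem_range] at h
    omega

theorem sum_kyCount_succ {n m : ℕ} (t : ℕ × ℕ) (hm : m ≠ n) (k : ℕ) :
    ∑ x ∈ Finset.range m, kyCount n t (k + 1) (x + 1, m) =
      ∑ y ∈ Finset.range (m + m), kyCount n t k
        (if n ≤ 2 * m then (if y + 1 ≤ n then (y + 1, n) else (y + 1 - n, 2 * m - n))
          else (y + 1, 2 * m)) := by
  rw [Finset.sum_range_add, ← Finset.sum_add_distrib]
  refine Finset.sum_congr rfl fun x _ => ?_
  simp only [kyCount, kyStep, if_neg hm, if_true, Bool.false_eq_true, if_false, add_zero]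
  rw [show x + 1 + m = m + x + 1 by ring, add_comm]

theorem sum_kyCount_bounds {n i : ℕ} (hi : 1 ≤ i) (hin : i ≤ n) (k : ℕ) :
    ∀ m ≤ n, n * ∑ x ∈ Finset.range m, kyCount n (i, n) k (x + 1, m) ≤ m * 2 ^ k ∧
      m * 2 ^ k ≤ n * ∑ x ∈ Finset.range m, kyCount n (i, n) k (x + 1, m) + n := by
  induction k with
  | zero =>
    intro m hm
    rcases hm.eq_or_lt with rfl | hlt
    · rw [sum_kyCount_of_absorbing hi hin]
      omega
    · simp [kyCount, hlt.ne, hm]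
  | succ k ih =>
    intro m hm
    rcases hm.eq_or_lt with rfl | hlt
    · rw [sum_kyCount_of_absorbing hi hin]
      omega
    rw [sum_kyCount_succ _ hlt.ne]
    by_cases h : n ≤ 2 * m
    · obtain ⟨r, hr⟩ := Nat.exists_eq_add_of_le h
      have key : ∑ y ∈ Finset.range (m + m), kyCount n (i, n) k
          (if n ≤ 2 * m then (if y + 1 ≤ n then (y + 1, n) else (y + 1 - n, 2 * m - n))
            else (y + 1, 2 * m)) =
          2 ^ k + ∑ x ∈ Finset.range r, kyCount n (i, n) k (x + 1, r) := by
        rw [← two_mul, hr, Finset.sum_range_add, ← sum_kyCount_of_absorbing hi hin k]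
        congr 1
        · refine Finset.sum_congr rfl fun x hx => ?_
          rw [Finset.mem_range] at hx
          rw [if_pos (by omega), if_pos (by omega)]
        · refine Finset.sum_congr rfl fun x _ => ?_
          rw [if_pos (by omega), if_neg (by omega)]
          congr 2 <;> omega
      rw [key]
      obtain ⟨h₁, h₂⟩ := ih r (by omega)
      have e : m * 2 ^ (k + 1) = n * 2 ^ k + r * 2 ^ k := by
        rw [← add_mul, ← hr]; ring
      rw [e, mul_add]
      omega
    · simp only [if_neg h, ← two_mul]
      have e : m * 2 ^ (k + 1) = 2 * m * 2 ^ k := by ring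
      rw [e]
      exact ih (2 * m) (by omega)

theorem kyState_congr (n : ℕ) {b f : ℕ → Bool} (j : ℕ) (h : ∀ i < j, b i = f i) :
    kyState n b j = kyState n f j := by
  induction j with
  | zero => rfl
  | succ j ih =>
    rw [kyState, kyState, ih fun i hi => h i (by omega), h j (by omega)]

theorem kyState_succ_update (n : ℕ) (f : ℕ → Bool) (j : ℕ) (B : Bool) :
    kyState n (Function.update f j B) (j + 1) = kyStep n (kyState n f j) B := by
  rw [kyState, Function.update_self,
    kyState_congr n j fun i hi => Function.update_of_ne hi.ne B f]

theorem forall_lt_succ_eq_update_iff {b f : ℕ → Bool} {j : ℕ} {B : Bool} :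
    (∀ i < j + 1, b i = Function.update f j B i) ↔ (∀ i < j, b i = f i) ∧ b j = B := by
  rw [Nat.forall_lt_succ_right, Function.update_self]
  refine and_congr_left fun _ => forall₂_congr fun i hi => ?_
  rw [Function.update_of_ne hi.ne]

theorem measure_cylinder_inter_kyState (n : ℕ) (μ : Measure (ℕ → Bool))
    (hμ : ∀ (k : ℕ) (f : ℕ → Bool), μ {b | ∀ i < k, b i = f i} = (2 : ℝ≥0∞)⁻¹ ^ k)
    (t : ℕ × ℕ) (k : ℕ) : ∀ (j : ℕ) (f : ℕ → Bool),
    μ {b | (∀ i < j, b i = f i) ∧ kyState n b (j + k) = t} =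
      (2 : ℝ≥0∞)⁻¹ ^ (j + k) * kyCount n t k (kyState n f j) := by
  induction k with
  | zero =>
    intro j f
    have e : {b : ℕ → Bool | (∀ i < j, b i = f i) ∧ kyState n b (j + 0) = t} =
        {b | (∀ i < j, b i = f i) ∧ kyState n f j = t} := by
      ext b
      exact and_congr_right fun h => by rw [add_zero, kyState_congr n j h]
    rw [e]
    by_cases h : kyState n f j = t <;> simp [h, kyCount, hμ]
  | succ k ih =>
    intro j f
    have hmeas : MeasurableSet {b : ℕ → Bool | b j = true} :=
      measurableSet_eq_fun (measurable_pi_apply j) measurable_const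
    rw [← measure_inter_add_sdiff _ hmeas]
    have e₁ : {b : ℕ → Bool | (∀ i < j, b i = f i) ∧ kyState n b (j + (k + 1)) = t} ∩
        {b | b j = true} = {b | (∀ i < j + 1, b i = Function.update f j true i) ∧
          kyState n b (j + 1 + k) = t} := by
      ext b
      simp only [Set.mem_inter_iff, Set.mem_ofPred_eq, forall_lt_succ_eq_update_iff,
        show j + (k + 1) = j + 1 + k by ring]
      tauto
    have e₂ : {b : ℕ → Bool | (∀ i < j, b i = f i) ∧ kyState n b (j + (k + 1)) = t} \
        {b | b j = true} = {b | (∀ i < j + 1, b i = Function.update f j false i) ∧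
          kyState n b (j + 1 + k) = t} := by
      ext b
      simp only [Set.mem_sdiff, Set.mem_ofPred_eq, forall_lt_succ_eq_update_iff,
        show j + (k + 1) = j + 1 + k by ring, Bool.not_eq_true]
      tauto
    rw [e₁, e₂, ih, ih, kyState_succ_update, kyState_succ_update, kyCount, Nat.cast_add,
      mul_add, show j + (k + 1) = j + 1 + k by ring]

theorem measure_kyState_eq (n : ℕ) (μ : Measure (ℕ → Bool))
    (hμ : ∀ (k : ℕ) (f : ℕ → Bool), μ {b | ∀ i < k, b i = f i} = (2 : ℝ≥0∞)⁻¹ ^ k)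
    (t : ℕ × ℕ) (k : ℕ) :
    μ {b | kyState n b k = t} = (2 : ℝ≥0∞)⁻¹ ^ k * kyCount n t k (1, 1) := by
  simpa [kyState] using measure_cylinder_inter_kyState n μ hμ t k 0 fun _ => false

theorem tendsto_kyCount {n i : ℕ} (hi : 1 ≤ i) (hin : i ≤ n) :
    Tendsto (fun k => (2 : ℝ≥0∞)⁻¹ ^ k * kyCount n (i, n) k (1, 1)) atTop
      (𝓝 (n : ℝ≥0∞)⁻¹) := by
  have hn : (0 : ℝ) < n := by exact_mod_cast hi.trans hin
  have hb (k : ℕ) : (n : ℝ) * kyCount n (i, n) k (1, 1) ≤ 2 ^ k ∧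
      (2 : ℝ) ^ k ≤ n * kyCount n (i, n) k (1, 1) + n := by
    have h := sum_kyCount_bounds hi hin k 1 (hi.trans hin)
    simp only [Finset.sum_range_one, zero_add, one_mul] at h
    exact_mod_cast h
  have hreal : Tendsto (fun k => (2 : ℝ)⁻¹ ^ k * kyCount n (i, n) k (1, 1)) atTop
      (𝓝 (n : ℝ)⁻¹) := by
    have hlow : Tendsto (fun k : ℕ => (n : ℝ)⁻¹ - (2 : ℝ)⁻¹ ^ k) atTop (𝓝 (n : ℝ)⁻¹) := by
      simpa using tendsto_const_nhds.sub
        (tendsto_pow_atTop_nhds_zero_of_lt_one (r := (2 : ℝ)⁻¹) (by norm_num) (by norm_num))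
    refine tendsto_of_tendsto_of_tendsto_of_le_of_le hlow tendsto_const_nhds
      (fun k => ?_) fun k => ?_
    · have := (hb k).2
      simp only [inv_pow]
      field_simp
      linarith
    · have := (hb k).1
      simp only [inv_pow]
      field_simp
      linarith
  have h := ENNReal.tendsto_ofReal hreal
  rw [ENNReal.ofReal_inv_of_pos hn, ENNReal.ofReal_natCast] at h
  refine h.congr fun k => ?_
  rw [ENNReal.ofReal_mul (by positivity), ENNReal.ofReal_pow (by norm_num),
    ENNReal.ofReal_inv_of_pos two_pos, ENNReal.ofReal_natCast, ENNReal.ofReal_ofNat]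

theorem kyState_of_le {n i : ℕ} {b : ℕ → Bool} {j k : ℕ} (hjk : j ≤ k)
    (h : kyState n b j = (i, n)) : kyState n b k = (i, n) := by
  induction k, hjk using Nat.le_induction with
  | base => exact h
  | succ k _ ih => rw [kyState, ih, kyStep_of_absorbing]

theorem measure_exists_kyState_eq {n i : ℕ} (hi : 1 ≤ i) (hin : i ≤ n)
    (μ : Measure (ℕ → Bool))
    (hμ : ∀ (k : ℕ) (f : ℕ → Bool), μ {b | ∀ i < k, b i = f i} = (2 : ℝ≥0∞)⁻¹ ^ k) :
    μ {b | ∃ k, kyState n b k = (i, n)} = (n : ℝ≥0∞)⁻¹ := by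
  have hmono : Monotone fun k => {b : ℕ → Bool | kyState n b k = (i, n)} :=
    fun _ _ hjk _ hb => kyState_of_le hjk hb
  have h := tendsto_measure_iUnion_atTop (μ := μ) hmono
  simp only [Function.comp_def, measure_kyState_eq n μ hμ, ← Set.ofPred_exists] at h
  exact tendsto_nhds_unique h (tendsto_kyCount hi hin)

theorem measurable_kyState (n k : ℕ) : Measurable fun b : ℕ → Bool => kyState n b k := by
  induction k with
  | zero => exact measurable_const
  | succ k ih =>
    exact (measurable_of_countable fun p : (ℕ × ℕ) × Bool => kyStep n p.1 p.2).comp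
      (ih.prodMk (measurable_pi_apply k))

theorem measurableSet_exists_kyState_eq (n : ℕ) (t : ℕ × ℕ) :
    MeasurableSet {b : ℕ → Bool | ∃ k, kyState n b k = t} := by
  rw [Set.ofPred_exists]
  exact MeasurableSet.iUnion fun k => measurable_kyState n k (measurableSet_singleton t)

theorem kyT_ne_top_iff {n : ℕ} {b : ℕ → Bool} :
    kyT n b ≠ ⊤ ↔ ∃ k, (kyState n b k).2 = n := by
  simp [kyT, iInf_eq_top]

theorem kyState_snd_of_kyT_eq {n k : ℕ} {b : ℕ → Bool} (h : kyT n b = k) :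
    (kyState n b k).2 = n := by
  have hex : ∃ k, (kyState n b k).2 = n := kyT_ne_top_iff.1 (h ▸ ENat.natCast_ne_top k)
  have hT : kyT n b = (Nat.find hex : ℕ) :=
    le_antisymm (iInf₂_le (Nat.find hex) (Nat.find_spec hex))
      (le_iInf₂ fun _ hk => Nat.cast_le.2 (Nat.find_min' hex hk))
  have : k = Nat.find hex := by exact_mod_cast h.symm.trans hT
  exact this ▸ Nat.find_spec hex

theorem exists_kyT_eq_and_iff {n i : ℕ} {b : ℕ → Bool} :
    (∃ k : ℕ, kyT n b = (k : ℕ∞) ∧ (kyState n b k).1 = i) ↔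
      ∃ k, kyState n b k = (i, n) := by
  constructor
  · rintro ⟨k, hT, hk⟩
    exact ⟨k, Prod.ext hk (kyState_snd_of_kyT_eq hT)⟩
  · rintro ⟨k, hk⟩
    have hsnd : (kyState n b k).2 = n := congrArg Prod.snd hk
    obtain ⟨j, hj⟩ := ENat.ne_top_iff_exists.1 (kyT_ne_top_iff.2 ⟨k, hsnd⟩)
    have hle : j ≤ k := by
      have : kyT n b ≤ k := iInf₂_le k hsnd
      rw [← hj] at this
      exact_mod_cast this
    have hs : kyState n b j = ((kyState n b j).1, n) :=
      Prod.ext rfl (kyState_snd_of_kyT_eq hj.symm)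
    exact ⟨j, hj.symm, congrArg Prod.fst ((kyState_of_le hle hs).symm.trans hk)⟩

/-- For `n ≥ 1`, the algorithm `optimal_uniform n`, run with i.i.d. fair
coin flips (i.e. under any probability measure `μ` on `ℕ → Bool` giving each cylinder set
on the first `k` coordinates measure `2⁻ᵏ`), terminates with probability 1, and for every
`i` with `1 ≤ i ≤ n` the probability that it terminates with output `i` is `1 / n`. -/
theorem optimal_uniform_correct (n : ℕ) (hn : 1 ≤ n)
    (μ : Measure (ℕ → Bool)) [IsProbabilityMeasure μ]
    (hμ : ∀ (k : ℕ) (f : ℕ → Bool), μ {b | ∀ i < k, b i = f i} = (2 : ℝ≥0∞)⁻¹ ^ k) :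
    μ {b | kyT n b ≠ ⊤} = 1 ∧
      ∀ i : ℕ, 1 ≤ i → i ≤ n →
        μ {b | ∃ k : ℕ, kyT n b = (k : ℕ∞) ∧ (kyState n b k).1 = i} = (n : ℝ≥0∞)⁻¹ := by
  refine ⟨le_antisymm prob_le_one ?_, fun i hi hin => ?_⟩
  · have hdisj : Set.PairwiseDisjoint (↑(Finset.Icc 1 n))
        fun i => {b : ℕ → Bool | ∃ k, kyState n b k = (i, n)} := by
      rintro i - j - hij
      refine Set.disjoint_left.2 ?_
      rintro b ⟨k, hk⟩ ⟨l, hl⟩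
      have h := (kyState_of_le (le_max_left k l) hk).symm.trans
        (kyState_of_le (le_max_right k l) hl)
      exact hij (congrArg Prod.fst h)
    calc (1 : ℝ≥0∞) = ∑ i ∈ Finset.Icc 1 n, μ {b | ∃ k, kyState n b k = (i, n)} := by
          rw [Finset.sum_congr rfl fun i hi => measure_exists_kyState_eq
            (Finset.mem_Icc.1 hi).1 (Finset.mem_Icc.1 hi).2 μ hμ]
          rw [Finset.sum_const, Nat.card_Icc, Nat.add_sub_cancel, nsmul_eq_mul,
            ENNReal.mul_inv_cancel (by exact_mod_cast (by omega : n ≠ 0))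
              (ENNReal.natCast_ne_top n)]
      _ = μ (⋃ i ∈ Finset.Icc 1 n, {b | ∃ k, kyState n b k = (i, n)}) :=
          (measure_biUnion_finset hdisj fun i _ => measurableSet_exists_kyState_eq n _).symm
      _ ≤ μ {b | kyT n b ≠ ⊤} := by
          refine measure_mono (Set.iUnion₂_subset ?_)
          rintro i - b ⟨k, hk⟩
          exact kyT_ne_top_iff.2 ⟨k, congrArg Prod.snd hk⟩
  · simp only [exists_kyT_eq_and_iff]
    exact measure_exists_kyState_eq hi hin μ hμ
end

section
/- Knuth–Yao characterization: a DDG (S_i)_{i ∈ I} for a probability mass function p is optimal if and only if for every outcome i ∈ I and every level j ∈ ℕ, the number of bit strings in S_i of length j equals ⌊2^j · p i⌋ − 2·⌊2^{j−1} · p i⌋ (the j-th bit in the binary expansion of p i, using the finite expansion when possible). -/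
open scoped ENNReal NNReal

/-- The weight `2^{-|w|}` of a bit string `w` (the probability that the string of fair
coin flips starts with `w`). -/
noncomputable def ddgWt (w : List Bool) : ℝ≥0 := (2 : ℝ≥0)⁻¹ ^ w.length

/-- A DDG (discrete distribution generating tree) for a probability mass function `p`
on an outcome set `I`: a family `S i` of pairwise disjoint sets of finite bit strings
whose union is prefix-free, with `∑_{w ∈ S i} 2^{-|w|} = p i` for every `i` and total
mass `1`. -/
structure IsDDG {I : Type*} (p : I → ℝ≥0) (S : I → Set (List Bool)) : Prop where
  pairwise_disjoint : Pairwise (Function.onFun Disjoint S)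
  prefixFree : ∀ w ∈ ⋃ i, S i, ∀ v ∈ ⋃ i, S i, w <+: v → w = v
  mass : ∀ i, ∑' w : (S i), ddgWt (w : List Bool) = p i
  total : ∑' w : (⋃ i, S i : Set (List Bool)), ddgWt (w : List Bool) = 1

/-- `P(N > j)`, where `N` is the number of flips used by the DDG `S`:
`1 - ∑_{w ∈ S, |w| ≤ j} 2^{-|w|}`. -/
noncomputable def ddgTail {I : Type*} (S : I → Set (List Bool)) (j : ℕ) : ℝ≥0 :=
  1 - ∑' w : ({w ∈ ⋃ i, S i | w.length ≤ j} : Set (List Bool)), ddgWt (w : List Bool)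

/-- A DDG for `p` is optimal if its flip count is stochastically dominated by that of
any other DDG for `p`: `P(N > j) ≤ P(N' > j)` for all `j`. -/
def IsOptimalDDG {I : Type*} (p : I → ℝ≥0) (S : I → Set (List Bool)) : Prop :=
  IsDDG p S ∧ ∀ S' : I → Set (List Bool), IsDDG p S' → ∀ j : ℕ, ddgTail S j ≤ ddgTail S' j

section FixedWidth

/-- The `k` lowest binary digits of `n`, most significant digit first. -/
def fixedWidthBits : ℕ → ℕ → List Bool
  | 0, _ => []
  | k + 1, n => fixedWidthBits k (n / 2) ++ [n.bodd]

theorem length_fixedWidthBits (k n : ℕ) : (fixedWidthBits k n).length = k := by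
  induction k generalizing n with
  | zero => rfl
  | succ k ih => simp [fixedWidthBits, ih]

theorem fixedWidthBits_prefix (k d n : ℕ) :
    fixedWidthBits k (n / 2 ^ d) <+: fixedWidthBits (k + d) n := by
  induction d generalizing n with
  | zero => simp
  | succ d ih =>
    have h := ih (n / 2)
    rw [Nat.div_div_eq_div_mul, ← pow_succ'] at h
    exact h.trans (List.prefix_append _ _)

theorem fixedWidthBits_injOn {k m n : ℕ} (hm : m < 2 ^ k) (hn : n < 2 ^ k)
    (h : fixedWidthBits k m = fixedWidthBits k n) : m = n := by
  induction k generalizing m n with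
  | zero => simp at hm hn; omega
  | succ k ih =>
    obtain ⟨h₁, h₂⟩ := List.append_inj' h rfl
    have h₃ := ih (by rw [pow_succ] at hm; omega) (by rw [pow_succ] at hn; omega) h₁
    have h₄ : m.bodd = n.bodd := by simpa using h₂
    rw [← Nat.bodd_add_div2 m, ← Nat.bodd_add_div2 n, h₄, Nat.div2_val, Nat.div2_val, h₃]

theorem eq_div_of_fixedWidthBits_prefix {k d m n : ℕ} (hm : m < 2 ^ k) (hn : n < 2 ^ (k + d))
    (h : fixedWidthBits k m <+: fixedWidthBits (k + d) n) : m = n / 2 ^ d := by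
  refine fixedWidthBits_injOn hm ?_ ?_
  · rw [Nat.div_lt_iff_lt_mul (by positivity), ← pow_add]
    exact hn
  · refine (List.prefix_of_prefix_length_le h (fixedWidthBits_prefix k d n) ?_).eq_of_length ?_ <;>
      simp [length_fixedWidthBits]

end FixedWidth

/-- The converse of Kraft's inequality for countably many code words. -/
theorem exists_prefixFree_of_tsum_le_one {T : Type*} [Countable T] (l : T → ℕ)
    (h : ∑' t, ((2 : ℝ≥0∞)⁻¹) ^ l t ≤ 1) :
    ∃ f : T → List Bool, (∀ t, (f t).length = l t) ∧ ∀ s t, f s <+: f t → s = t := by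
  obtain ⟨e, he⟩ := exists_injective_nat T
  let key : T → ℕ ×ₗ ℕ := fun t ↦ toLex (l t, e t)
  have key_inj : Function.Injective key := fun s t hst ↦ he (congrArg (fun x ↦ (ofLex x).2) hst)
  have le_of_key {s t : T} (hst : key s < key t) : l s ≤ l t := by
    rcases Prod.Lex.lt_iff.1 hst with h | h
    · exact h.le
    · exact h.1.le
  have fin (t : T) : {s | key s < key t}.Finite := by
    refine (ENNReal.finite_const_le_of_tsum_ne_top (ne_top_of_le_ne_top ENNReal.one_ne_top h)
      (ε := (2 : ℝ≥0∞)⁻¹ ^ l t) (by simp)).subset fun s hs ↦ ?_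
    exact pow_le_pow_right_of_le_one' (ENNReal.inv_le_one.2 one_le_two) (le_of_key hs)
  let P : T → Finset T := fun t ↦ (fin t).toFinset
  have mem_P {s t : T} : s ∈ P t ↔ key s < key t := by simp [P]
  let n : T → ℕ := fun t ↦ ∑ s ∈ P t, 2 ^ (l t - l s)
  have not_mem (t : T) : t ∉ P t := by simp [mem_P]
  have n_lt (t : T) : n t < 2 ^ l t := by
    have h₁ : ∑ s ∈ (P t).cons t (not_mem t), ((2 : ℝ≥0∞)⁻¹) ^ l s ≤ 1 :=
      (ENNReal.sum_le_tsum _).trans h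
    have h₂ : ∑ s ∈ (P t).cons t (not_mem t), ((2 : ℝ≥0∞)⁻¹) ^ l s * 2 ^ l t
        = ((n t + 1 : ℕ) : ℝ≥0∞) := by
      have aux (s : T) (hs : l s ≤ l t) :
          ((2 : ℝ≥0∞)⁻¹) ^ l s * 2 ^ l t = 2 ^ (l t - l s) := by
        obtain ⟨d, hd⟩ := Nat.exists_eq_add_of_le hs
        rw [hd, pow_add, ← mul_assoc, ← mul_pow,
          ENNReal.inv_mul_cancel (by simp) (by simp), one_pow, one_mul, Nat.add_sub_cancel_left]
      rw [Finset.sum_cons, aux t le_rfl,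
        Finset.sum_congr rfl fun s hs ↦ aux s (le_of_key (mem_P.1 hs))]
      simp [n, add_comm]
    rw [← Finset.sum_mul] at h₂
    have h₃ : ((n t + 1 : ℕ) : ℝ≥0∞) ≤ ((2 ^ l t : ℕ) : ℝ≥0∞) := by
      rw [← h₂]
      push_cast
      exact mul_le_of_le_one_left' h₁
    exact_mod_cast h₃
  have n_gap {s t : T} (hst : key s < key t) : (n s + 1) * 2 ^ (l t - l s) ≤ n t := by
    have h₁ : (P s).cons s (not_mem s) ⊆ P t := by
      intro r hr
      rw [Finset.mem_cons] at hr
      rcases hr with rfl | hr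
      · exact mem_P.2 hst
      · exact mem_P.2 ((mem_P.1 hr).trans hst)
    refine le_trans (le_of_eq ?_) (Finset.sum_le_sum_of_subset h₁)
    rw [Finset.sum_cons, add_mul, Finset.sum_mul, one_mul, add_comm]
    congr 1
    refine Finset.sum_congr rfl fun r hr ↦ ?_
    have h₂ := le_of_key (mem_P.1 hr)
    have h₃ := le_of_key hst
    rw [← pow_add]
    congr 1
    omega
  refine ⟨fun t ↦ fixedWidthBits (l t) (n t), fun t ↦ length_fixedWidthBits _ _, ?_⟩
  intro s t hst
  have hle : l s ≤ l t := by simpa [length_fixedWidthBits] using hst.length_le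
  obtain ⟨d, hd⟩ := Nat.exists_eq_add_of_le hle
  have hdiv : n s = n t / 2 ^ d := by
    have := n_lt t
    simp only [hd] at hst this
    exact eq_div_of_fixedWidthBits_prefix (n_lt s) this hst
  rcases lt_trichotomy (key s) (key t) with hlt | heq | hgt
  · have h₁ := n_gap hlt
    rw [hd, Nat.add_sub_cancel_left, ← Nat.le_div_iff_mul_le (by positivity)] at h₁
    omega
  · exact key_inj heq
  · have h₁ := n_gap hgt
    have h₂ : d = 0 := by have := le_of_key hgt; omega
    subst h₂
    simp at hdiv hd
    simp [hd] at h₁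
    omega

section BinaryDigit

/-- The `j`-th digit of the binary expansion of `x ∈ [0, 1]`. -/
noncomputable def binaryDigit (x : ℝ≥0) (j : ℕ) : ℕ :=
  ⌊(2 : ℝ≥0) ^ (j : ℤ) * x⌋₊ - 2 * ⌊(2 : ℝ≥0) ^ ((j : ℤ) - 1) * x⌋₊

theorem binaryDigit_zero {x : ℝ≥0} (hx : x ≤ 1) : binaryDigit x 0 = ⌊x⌋₊ := by
  have h : ⌊(2 : ℝ≥0)⁻¹ * x⌋₊ = 0 := by
    rw [Nat.floor_eq_zero]
    calc (2 : ℝ≥0)⁻¹ * x ≤ 2⁻¹ * 1 := by gcongr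
      _ < 1 := by rw [mul_one]; exact inv_lt_one_of_one_lt₀ one_lt_two
  simp [binaryDigit, h]

theorem floor_two_pow_succ_mul (x : ℝ≥0) (j : ℕ) :
    ⌊2 ^ (j + 1) * x⌋₊ = 2 * ⌊2 ^ j * x⌋₊ + binaryDigit x (j + 1) := by
  have h : 2 * ⌊2 ^ j * x⌋₊ ≤ ⌊2 ^ (j + 1) * x⌋₊ := by
    rw [Nat.le_floor_iff (by positivity), pow_succ', mul_assoc]
    push_cast
    gcongr
    exact Nat.floor_le (by positivity)
  have h₁ : (2 : ℝ≥0) ^ ((j + 1 : ℕ) : ℤ) = 2 ^ (j + 1) := zpow_natCast _ _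
  have h₂ : (2 : ℝ≥0) ^ (((j + 1 : ℕ) : ℤ) - 1) = 2 ^ j := by
    rw [Nat.cast_add_one, add_sub_cancel_right, zpow_natCast]
  rw [binaryDigit, h₁, h₂]
  omega

theorem sum_binaryDigit {x : ℝ≥0} (hx : x ≤ 1) (n : ℕ) :
    ∑ j ∈ Finset.range (n + 1), (binaryDigit x j : ℝ≥0) * 2⁻¹ ^ j = ⌊2 ^ n * x⌋₊ / 2 ^ n := by
  induction n with
  | zero => simp [binaryDigit_zero hx]
  | succ n ih =>
    rw [Finset.sum_range_succ, ih, floor_two_pow_succ_mul]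
    push_cast
    rw [pow_succ, inv_pow]
    field_simp
    ring

theorem tendsto_floor_two_pow_mul_div (x : ℝ≥0) :
    Filter.Tendsto (fun n : ℕ ↦ (⌊2 ^ n * x⌋₊ : ℝ≥0) / 2 ^ n) Filter.atTop (nhds x) := by
  have h := (tendsto_nat_floor_mul_div_atTop x.2).comp
    (tendsto_pow_atTop_atTop_of_one_lt (one_lt_two (α := ℝ)))
  rw [← NNReal.tendsto_coe]
  refine h.congr fun n ↦ ?_
  have : ⌊(x : ℝ) * 2 ^ n⌋₊ = ⌊2 ^ n * x⌋₊ := by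
    rw [Nat.floor_eq_iff (by positivity)]
    have h₁ := Nat.floor_le (zero_le (a := 2 ^ n * x))
    have h₂ := Nat.lt_floor_add_one (2 ^ n * x)
    rw [mul_comm (x : ℝ)]
    exact ⟨by exact_mod_cast h₁, by exact_mod_cast h₂⟩
  simp [this]

theorem tsum_binaryDigit {x : ℝ≥0} (hx : x ≤ 1) :
    ∑' j, (binaryDigit x j : ℝ≥0∞) * 2⁻¹ ^ j = x := by
  refine tendsto_nhds_unique ((ENNReal.tendsto_nat_tsum _).comp (Filter.tendsto_add_atTop_nat 1)) ?_
  refine (ENNReal.tendsto_coe.2 (tendsto_floor_two_pow_mul_div x)).congr fun n ↦ ?_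
  rw [← sum_binaryDigit hx n]
  push_cast
  simp

end BinaryDigit

section Mass

/-- The total weight of a set of bit strings, as an extended nonnegative real. -/
noncomputable def bitMass (A : Set (List Bool)) : ℝ≥0∞ := ∑' w : A, (ddgWt w : ℝ≥0∞)

theorem coe_ddgWt (w : List Bool) : (ddgWt w : ℝ≥0∞) = 2⁻¹ ^ w.length := by
  simp [ddgWt, ENNReal.inv_pow]

theorem bitMass_mono {A B : Set (List Bool)} (h : A ⊆ B) : bitMass A ≤ bitMass B :=
  ENNReal.tsum_mono_subtype (fun w ↦ (ddgWt w : ℝ≥0∞)) h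

theorem bitMass_iUnion {I : Type*} {S : I → Set (List Bool)}
    (h : Pairwise (Function.onFun Disjoint S)) : bitMass (⋃ i, S i) = ∑' i, bitMass (S i) :=
  ENNReal.tsum_biUnion (f := fun w ↦ (ddgWt w : ℝ≥0∞)) fun _ _ _ _ hij ↦ h hij

theorem coe_tsum_ddgWt_of_bitMass_ne_top {A : Set (List Bool)} (h : bitMass A ≠ ∞) :
    ((∑' w : A, ddgWt w : ℝ≥0) : ℝ≥0∞) = bitMass A :=
  ENNReal.coe_tsum (ENNReal.tsum_coe_ne_top_iff_summable.1 h)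

/-- The number of words of length `j` in a set of bit strings. -/
noncomputable def levelCount (A : Set (List Bool)) (j : ℕ) : ℕ :=
  ({w ∈ A | w.length = j} : Set (List Bool)).ncard

/-- The number of nodes at depth `j` of the binary tree which lie below a word of `A`, when `A` is
prefix-free. -/
noncomputable def coveredCount (A : Set (List Bool)) : ℕ → ℕ
  | 0 => levelCount A 0
  | j + 1 => 2 * coveredCount A j + levelCount A (j + 1)

theorem bitMass_level (A : Set (List Bool)) (j : ℕ) :
    bitMass {w ∈ A | w.length = j} = levelCount A j * 2⁻¹ ^ j := by
  have hfin : ({w ∈ A | w.length = j} : Set (List Bool)).Finite :=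
    (List.finite_length_eq Bool j).subset fun w hw ↦ hw.2
  calc bitMass {w ∈ A | w.length = j}
      = ∑' _ : ({w ∈ A | w.length = j} : Set (List Bool)), (2⁻¹ : ℝ≥0∞) ^ j :=
        tsum_congr fun w ↦ by rw [coe_ddgWt, w.2.2]
    _ = _ := by rw [ENNReal.tsum_set_const, levelCount, ← hfin.cast_ncard_eq]; simp

theorem bitMass_truncate (A : Set (List Bool)) (j : ℕ) :
    bitMass {w ∈ A | w.length ≤ j} = coveredCount A j * 2⁻¹ ^ j := by
  induction j with
  | zero => simpa [coveredCount] using bitMass_level A 0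
  | succ j ih =>
    have h : ({w ∈ A | w.length ≤ j + 1} : Set (List Bool))
        = {w ∈ A | w.length ≤ j} ∪ {w ∈ A | w.length = j + 1} := by
      ext w
      simp only [Set.mem_ofPred_eq, Set.mem_union, Nat.le_succ_iff]
      tauto
    have hd : Disjoint ({w ∈ A | w.length ≤ j} : Set (List Bool)) {w ∈ A | w.length = j + 1} := by
      rw [Set.disjoint_left]
      rintro w ⟨-, h₁⟩ ⟨-, h₂⟩
      omega
    rw [h, bitMass, ENNReal.summable.tsum_union_disjoint (f := fun w ↦ (ddgWt w : ℝ≥0∞)) hd ENNReal.summable]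
    change bitMass _ + bitMass _ = _
    rw [ih, bitMass_level, coveredCount, pow_succ']
    push_cast
    rw [add_mul, mul_comm (2 : ℝ≥0∞), mul_assoc _ (2 : ℝ≥0∞), ← mul_assoc (2 : ℝ≥0∞),
      ENNReal.mul_inv_cancel (by simp) (by simp), one_mul]

theorem coveredCount_le_floor {A : Set (List Bool)} {x : ℝ≥0} (h : bitMass A = x) (j : ℕ) :
    coveredCount A j ≤ ⌊2 ^ j * x⌋₊ := by
  rw [Nat.le_floor_iff (by positivity)]
  have h₁ : (coveredCount A j : ℝ≥0∞) * 2⁻¹ ^ j ≤ x := by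
    rw [← bitMass_truncate, ← h]
    exact bitMass_mono (Set.sep_subset _ _)
  rw [← ENNReal.inv_pow, ← div_eq_mul_inv, ENNReal.div_le_iff (by simp) (by simp), mul_comm] at h₁
  exact_mod_cast h₁

theorem forall_levelCount_eq_iff {x : ℝ≥0} (hx : x ≤ 1) (A : Set (List Bool)) :
    (∀ j, levelCount A j = binaryDigit x j) ↔ ∀ j, coveredCount A j = ⌊2 ^ j * x⌋₊ := by
  constructor
  · intro h j
    induction j with
    | zero => simp [coveredCount, h, binaryDigit_zero hx]
    | succ j ih => rw [coveredCount, ih, h, floor_two_pow_succ_mul]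
  · intro h j
    cases j with
    | zero => simpa [coveredCount, binaryDigit_zero hx] using h 0
    | succ j =>
      have h₁ := h (j + 1)
      rw [coveredCount, h j, floor_two_pow_succ_mul] at h₁
      omega

end Mass

section DDG

variable {I : Type*} {p : I → ℝ≥0} {S : I → Set (List Bool)}

theorem IsDDG.bitMass_iUnion_eq_one (hS : IsDDG p S) : bitMass (⋃ i, S i) = 1 := by
  have hs : Summable fun w : (⋃ i, S i : Set (List Bool)) ↦ ddgWt (w : List Bool) := by
    by_contra h
    simpa [tsum_eq_zero_of_not_summable h] using hS.total
  rw [bitMass, ← ENNReal.coe_tsum hs, hS.total, ENNReal.coe_one]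

theorem IsDDG.bitMass_eq (hS : IsDDG p S) (i : I) : bitMass (S i) = p i := by
  have h : bitMass (S i) ≤ 1 :=
    hS.bitMass_iUnion_eq_one ▸ bitMass_mono (Set.subset_iUnion S i)
  rw [← hS.mass i, coe_tsum_ddgWt_of_bitMass_ne_top (ne_top_of_le_ne_top ENNReal.one_ne_top h)]

theorem IsDDG.of_bitMass (hd : Pairwise (Function.onFun Disjoint S))
    (hf : ∀ w ∈ ⋃ i, S i, ∀ v ∈ ⋃ i, S i, w <+: v → w = v)
    (hm : ∀ i, bitMass (S i) = p i) (hp : ∑' i, (p i : ℝ≥0∞) = 1) : IsDDG p S where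
  pairwise_disjoint := hd
  prefixFree := hf
  mass i := by
    rw [← ENNReal.coe_inj, coe_tsum_ddgWt_of_bitMass_ne_top (by simp [hm]), hm]
  total := by
    have h : bitMass (⋃ i, S i) = 1 := by simp only [bitMass_iUnion hd, hm, hp]
    rw [← ENNReal.coe_inj, coe_tsum_ddgWt_of_bitMass_ne_top (by simp [h]), h, ENNReal.coe_one]

theorem IsDDG.bitMass_truncate_iUnion (hS : IsDDG p S) (j : ℕ) :
    bitMass {w ∈ ⋃ i, S i | w.length ≤ j} = ∑' i, (coveredCount (S i) j : ℝ≥0∞) * 2⁻¹ ^ j := by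
  have h : ({w ∈ ⋃ i, S i | w.length ≤ j} : Set (List Bool))
      = ⋃ i, {w ∈ S i | w.length ≤ j} := by
    ext w
    simp
  rw [h, bitMass_iUnion]
  · exact tsum_congr fun i ↦ bitMass_truncate _ _
  · exact fun i k hik ↦
      (hS.pairwise_disjoint hik).mono (Set.sep_subset _ _) (Set.sep_subset _ _)

theorem IsDDG.bitMass_truncate_iUnion_le_one (hS : IsDDG p S) (j : ℕ) :
    bitMass {w ∈ ⋃ i, S i | w.length ≤ j} ≤ 1 :=
  hS.bitMass_iUnion_eq_one ▸ bitMass_mono (Set.sep_subset _ _)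

theorem IsDDG.coe_ddgTail (hS : IsDDG p S) (j : ℕ) :
    (ddgTail S j : ℝ≥0∞) = 1 - bitMass {w ∈ ⋃ i, S i | w.length ≤ j} := by
  rw [ddgTail, ENNReal.coe_sub, coe_tsum_ddgWt_of_bitMass_ne_top, ENNReal.coe_one]
  exact ne_top_of_le_ne_top ENNReal.one_ne_top (hS.bitMass_truncate_iUnion_le_one j)

theorem IsDDG.ddgTail_le_iff {S' : I → Set (List Bool)} (hS : IsDDG p S) (hS' : IsDDG p S')
    (j : ℕ) : ddgTail S j ≤ ddgTail S' j ↔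
      ∑' i, (coveredCount (S' i) j : ℝ≥0∞) * 2⁻¹ ^ j
        ≤ ∑' i, (coveredCount (S i) j : ℝ≥0∞) * 2⁻¹ ^ j := by
  rw [← ENNReal.coe_le_coe, hS.coe_ddgTail, hS'.coe_ddgTail, ← hS.bitMass_truncate_iUnion,
    ← hS'.bitMass_truncate_iUnion]
  refine ⟨fun h ↦ ?_, fun h ↦ tsub_le_tsub_left h _⟩
  have h₁ := tsub_le_tsub_left h 1
  rwa [ENNReal.sub_sub_cancel ENNReal.one_ne_top (hS'.bitMass_truncate_iUnion_le_one j),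
    ENNReal.sub_sub_cancel ENNReal.one_ne_top (hS.bitMass_truncate_iUnion_le_one j)] at h₁

/-- The Knuth–Yao construction. -/
theorem exists_isDDG_levelCount_eq_binaryDigit [Countable I] (hp : ∑' i, (p i : ℝ≥0∞) = 1) :
    ∃ S : I → Set (List Bool), IsDDG p S ∧ ∀ i j, levelCount (S i) j = binaryDigit (p i) j := by
  have hp_le (i : I) : p i ≤ 1 := by
    have h := ENNReal.le_tsum (f := fun i ↦ (p i : ℝ≥0∞)) i
    rw [hp] at h
    exact_mod_cast h
  have hdigits (i : I) :
      ∑' t : (j : ℕ) × Fin (binaryDigit (p i) j), (2⁻¹ : ℝ≥0∞) ^ t.1 = p i := by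
    rw [ENNReal.tsum_sigma', ← tsum_binaryDigit (hp_le i)]
    exact tsum_congr fun j ↦ by simp
  obtain ⟨f, hlen, hpre⟩ := exists_prefixFree_of_tsum_le_one
    (T := (i : I) × (j : ℕ) × Fin (binaryDigit (p i) j)) (fun t ↦ t.2.1) (by
      rw [ENNReal.tsum_sigma']
      simp only [hdigits, hp, le_refl])
  have hinj : Function.Injective f := fun s t h ↦ hpre s t (h ▸ List.prefix_rfl)
  have hinj_i (i : I) : Function.Injective fun t ↦ f ⟨i, t⟩ :=
    hinj.comp sigma_mk_injective
  refine ⟨fun i ↦ Set.range fun t ↦ f ⟨i, t⟩, IsDDG.of_bitMass ?_ ?_ ?_ hp, ?_⟩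
  · intro i k hik
    rw [Function.onFun, Set.disjoint_left]
    rintro _ ⟨s, rfl⟩ ⟨t, h⟩
    exact hik (congrArg Sigma.fst (hinj h)).symm
  · simp only [Set.mem_iUnion, Set.mem_range]
    rintro _ ⟨i, s, rfl⟩ _ ⟨k, t, rfl⟩ h
    rw [hpre _ _ h]
  · intro i
    rw [bitMass, tsum_range (fun w ↦ (ddgWt w : ℝ≥0∞)) (hinj_i i), ← hdigits i]
    exact tsum_congr fun t ↦ by rw [coe_ddgWt, hlen]
  · intro i j
    have h : {w ∈ Set.range fun t ↦ f ⟨i, t⟩ | w.length = j}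
        = Set.range fun a : Fin (binaryDigit (p i) j) ↦ f ⟨i, j, a⟩ := by
      ext w
      constructor
      · rintro ⟨⟨⟨k, a⟩, rfl⟩, hk⟩
        obtain rfl : k = j := (hlen _).symm.trans hk
        exact ⟨a, rfl⟩
      · rintro ⟨a, rfl⟩
        exact ⟨⟨⟨j, a⟩, rfl⟩, hlen _⟩
    rw [levelCount, h, ← Set.image_univ,
      Set.ncard_image_of_injective _ (f := fun a ↦ f ⟨i, j, a⟩)
        ((hinj_i i).comp sigma_mk_injective)]
    simp

end DDG

/-- Knuth–Yao characterization. A DDG `S` for a probability mass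
function `p` on a countable outcome set is optimal if and only if for every outcome
`i` and every level `j`, the number of bit strings in `S i` of length `j` equals
`⌊2^j · p i⌋ − 2⌊2^{j−1} · p i⌋`, the `j`-th bit of the binary expansion of `p i`. -/
theorem ddg_optimal_iff_binary_bits {I : Type*} [Countable I]
    (p : I → ℝ≥0) (hp : ∑' i, p i = 1)
    (S : I → Set (List Bool)) (hS : IsDDG p S) :
    IsOptimalDDG p S ↔
      ∀ (i : I) (j : ℕ),
        ({w ∈ S i | w.length = j} : Set (List Bool)).ncard
          = ⌊(2 : ℝ≥0) ^ (j : ℤ) * p i⌋₊ - 2 * ⌊(2 : ℝ≥0) ^ ((j : ℤ) - 1) * p i⌋₊ := by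
  have hp' : ∑' i, (p i : ℝ≥0∞) = 1 := by
    rw [← hS.bitMass_iUnion_eq_one, bitMass_iUnion hS.pairwise_disjoint]
    exact tsum_congr fun i ↦ (hS.bitMass_eq i).symm
  have hp_le (i : I) : p i ≤ 1 := by
    have h := ENNReal.le_tsum (f := fun i ↦ (p i : ℝ≥0∞)) i
    rw [hp'] at h
    exact_mod_cast h
  change _ ↔ ∀ i j, levelCount (S i) j = binaryDigit (p i) j
  simp only [fun i ↦ forall_levelCount_eq_iff (hp_le i) (S i)]
  constructor
  · rintro ⟨-, hopt⟩ i j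
    obtain ⟨S', hS', hdigit⟩ := exists_isDDG_levelCount_eq_binaryDigit hp'
    have hcov (i : I) := (forall_levelCount_eq_iff (hp_le i) (S' i)).1 (hdigit i)
    have hle := (hS.ddgTail_le_iff hS' j).1 (hopt S' hS' j)
    refine (coveredCount_le_floor (hS.bitMass_eq i) j).antisymm (not_lt.1 fun hlt ↦ hle.not_gt ?_)
    refine ENNReal.tsum_lt_tsum (i := i) ?_ (fun k ↦ ?_) ?_
    · rw [← hS.bitMass_truncate_iUnion]
      exact ne_top_of_le_ne_top ENNReal.one_ne_top (hS.bitMass_truncate_iUnion_le_one j)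
    · rw [hcov]
      gcongr
      exact coveredCount_le_floor (hS.bitMass_eq k) j
    · rw [hcov]
      exact (ENNReal.mul_lt_mul_iff_left (by simp) (by simp)).2 (by exact_mod_cast hlt)
  · refine fun h ↦ ⟨hS, fun S' hS' j ↦ (hS.ddgTail_le_iff hS' j).2 ?_⟩
    refine ENNReal.tsum_le_tsum fun i ↦ ?_
    rw [h]
    gcongr
    exact coveredCount_le_floor (hS'.bitMass_eq i) j
end

section
/- Fix an integer n ≥ 1. The number of flips T used by optimal_uniform(n) has the optimal tail distribution: for every j ∈ ℕ, μ({b : T(b) > j}) = (2^j mod n) / 2^j. -/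
open MeasureTheory
open scoped ENNReal NNReal

theorem Nat.two_pow_succ_mod_of_lt {n j : ℕ} (h : 2 * (2 ^ j % n) < n) :
    2 ^ (j + 1) % n = 2 * (2 ^ j % n) := by
  rw [pow_succ', ← Nat.mul_mod_mod, Nat.mod_eq_of_lt h]

theorem Nat.two_pow_succ_mod_of_le {n j : ℕ} (hn : 1 ≤ n) (h : n ≤ 2 * (2 ^ j % n)) :
    2 ^ (j + 1) % n = 2 * (2 ^ j % n) - n := by
  have hlt : 2 ^ j % n < n := Nat.mod_lt _ hn
  rw [pow_succ', ← Nat.mul_mod_mod, Nat.mod_eq_sub_mod h, Nat.mod_eq_of_lt (by omega)]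

/-- Before termination, `m_j = 2 ^ j mod n` and `X_j` lies between `1` and `m_j`. -/
theorem kyState_snd_eq_or {n : ℕ} (hn : 1 ≤ n) (b : ℕ → Bool) (j : ℕ) :
    (kyState n b j).2 = n ∨ ((kyState n b j).2 = 2 ^ j % n ∧
      1 ≤ (kyState n b j).1 ∧ (kyState n b j).1 ≤ 2 ^ j % n) := by
  induction j with
  | zero =>
    rcases hn.eq_or_lt with rfl | h
    · simp [kyState]
    · simp [kyState, Nat.mod_eq_of_lt h]
  | succ j ih =>
    have hlt : 2 ^ j % n < n := Nat.mod_lt _ hn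
    rw [kyState]
    generalize kyState n b j = s at ih ⊢
    obtain ⟨x, m⟩ := s
    rcases ih with h | ⟨h, h1, h2⟩
    · left
      simp_all [kyStep]
    · simp only at h h1 h2
      subst h
      rcases lt_or_ge (2 * (2 ^ j % n)) n with hr | hr
      · rw [Nat.two_pow_succ_mod_of_lt hr]
        cases b j <;> simp only [kyStep] <;> split_ifs <;> simp_all <;> omega
      · rw [Nat.two_pow_succ_mod_of_le hn hr]
        cases b j <;> simp only [kyStep] <;> split_ifs <;> simp_all <;> omega

/-- Every live state at time `j` is reached along exactly one string of `j` flips. -/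
theorem exists_forall_kyState_eq_iff {n : ℕ} (hn : 1 ≤ n) (j : ℕ) :
    ∀ x, 1 ≤ x → x ≤ 2 ^ j % n → ∃ f : ℕ → Bool, ∀ b,
      kyState n b j = (x, 2 ^ j % n) ↔ ∀ i < j, b i = f i := by
  induction j with
  | zero =>
    intro x h1 h2
    rcases hn.eq_or_lt with rfl | h
    · simp at h2
      omega
    · rw [pow_zero, Nat.mod_eq_of_lt h] at *
      obtain rfl : x = 1 := by omega
      simp [kyState]
  | succ j ih =>
    intro x h1 h2
    have hlt : 2 ^ j % n < n := Nat.mod_lt _ hn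
    suffices ∃ y c, (1 ≤ y ∧ y ≤ 2 ^ j % n) ∧ ∀ b, kyState n b (j + 1) = (x, 2 ^ (j + 1) % n) ↔
        kyState n b j = (y, 2 ^ j % n) ∧ b j = c by
      obtain ⟨y, c, ⟨hy1, hy2⟩, hy⟩ := this
      obtain ⟨f, hf⟩ := ih y hy1 hy2
      refine ⟨Function.update f j c, fun b => ?_⟩
      rw [hy, hf, Nat.forall_lt_succ_right]
      refine and_congr (forall₂_congr fun i hi => ?_) (by simp)
      rw [Function.update_of_ne hi.ne]
    obtain ⟨z, hz1, hz2, hz⟩ : ∃ z, 1 ≤ z ∧ z ≤ 2 * (2 ^ j % n) ∧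
        ((2 * (2 ^ j % n) < n ∧ z = x ∧ 2 ^ (j + 1) % n = 2 * (2 ^ j % n)) ∨
        (n ≤ 2 * (2 ^ j % n) ∧ z = x + n ∧ 2 ^ (j + 1) % n = 2 * (2 ^ j % n) - n)) := by
      rcases lt_or_ge (2 * (2 ^ j % n)) n with hr | hr
      · have := Nat.two_pow_succ_mod_of_lt hr
        exact ⟨x, by omega, by omega, by omega⟩
      · have := Nat.two_pow_succ_mod_of_le hn hr
        exact ⟨x + n, by omega, by omega, by omega⟩
    refine ⟨if z ≤ 2 ^ j % n then z else z - 2 ^ j % n, decide (2 ^ j % n < z),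
      by split_ifs <;> omega, fun b => ?_⟩
    have hs := kyState_snd_eq_or hn b j
    rw [kyState]
    generalize kyState n b j = s at hs ⊢
    obtain ⟨w, m⟩ := s
    generalize 2 ^ (j + 1) % n = r' at *
    generalize 2 ^ j % n = r at *
    simp only at hs
    rcases le_or_gt z r with hzr | hzr
    · rw [if_pos hzr, decide_eq_false hzr.not_gt]
      cases b j <;> simp only [kyStep, if_true, if_false, Bool.false_eq_true, reduceCtorEq,
        and_true, and_false, iff_false] <;>
      split_ifs <;> simp only [Prod.mk.injEq] <;> omega
    · rw [if_neg hzr.not_ge, decide_eq_true hzr]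
      cases b j <;> simp only [kyStep, if_true, if_false, Bool.false_eq_true,
        and_true, and_false, iff_false] <;>
      split_ifs <;> simp only [Prod.mk.injEq] <;> omega

theorem kyState_snd_eq_of_le {n : ℕ} {b : ℕ → Bool} {k j : ℕ} (hkj : k ≤ j)
    (h : (kyState n b k).2 = n) : (kyState n b j).2 = n := by
  induction j, hkj using Nat.le_induction with
  | base => exact h
  | succ j _ ih => simp [kyState, kyStep, ih]

theorem lt_kyT_iff {n : ℕ} {b : ℕ → Bool} {j : ℕ} :
    (j : ℕ∞) < kyT n b ↔ (kyState n b j).2 ≠ n := by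
  refine ⟨fun h hj => h.not_ge (iInf₂_le j hj), fun h => ?_⟩
  have hlt : (j : ℕ∞) < ((j + 1 : ℕ) : ℕ∞) := by exact_mod_cast Nat.lt_succ_self j
  refine hlt.trans_le (le_iInf₂ fun k hk => ?_)
  have : j < k := not_le.1 fun hkj => h (kyState_snd_eq_of_le hkj hk)
  exact_mod_cast this

theorem measurableSet_forall_lt_eq (k : ℕ) (f : ℕ → Bool) :
    MeasurableSet {b : ℕ → Bool | ∀ i < k, b i = f i} := by
  simp only [Set.ofPred_forall]
  exact .iInter fun i => .iInter fun _ => 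
    measurableSet_eq_fun (measurable_pi_apply i) measurable_const

/-- The number of flips `T` used by `optimal_uniform n` has the
optimal tail distribution: for every `j`, `μ(T > j) = (2^j mod n) / 2^j`. -/
theorem optimal_uniform_tail (n : ℕ) (hn : 1 ≤ n)
    (μ : Measure (ℕ → Bool)) [IsProbabilityMeasure μ]
    (hμ : ∀ (k : ℕ) (f : ℕ → Bool), μ {b | ∀ i < k, b i = f i} = (2 : ℝ≥0∞)⁻¹ ^ k) :
    ∀ j : ℕ, μ {b | (j : ℕ∞) < kyT n b} = ((2 ^ j % n : ℕ) : ℝ≥0∞) / (2 ^ j : ℝ≥0∞) := by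
  intro j
  have hlt : 2 ^ j % n < n := Nat.mod_lt _ hn
  choose! f hf using exists_forall_kyState_eq_iff hn j
  have hcyl : ∀ x ∈ Finset.Icc 1 (2 ^ j % n),
      {b | kyState n b j = (x, 2 ^ j % n)} = {b | ∀ i < j, b i = f x i} := fun x hx => by
    ext b
    exact hf x (Finset.mem_Icc.1 hx).1 (Finset.mem_Icc.1 hx).2 b
  have hunion : {b | (j : ℕ∞) < kyT n b} =
      ⋃ x ∈ Finset.Icc 1 (2 ^ j % n), {b | kyState n b j = (x, 2 ^ j % n)} := by
    ext b
    simp only [Set.mem_ofPred_eq, lt_kyT_iff, Set.mem_iUnion, Finset.mem_Icc, exists_prop]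
    constructor
    · intro h
      obtain ⟨h0, h1, h2⟩ := (kyState_snd_eq_or hn b j).resolve_left h
      exact ⟨_, ⟨h1, h2⟩, Prod.ext rfl h0⟩
    · rintro ⟨x, -, hx⟩
      rw [hx]
      exact hlt.ne
  rw [hunion, measure_biUnion_finset]
  · rw [Finset.sum_congr rfl fun x hx => by rw [hcyl x hx, hμ]]
    simp [div_eq_mul_inv, ENNReal.inv_pow]
  · intro x _ y _ hxy
    refine Set.disjoint_left.2 fun b hx hy => hxy ?_
    exact congrArg Prod.fst ((Set.mem_ofPred_eq ▸ hx : _ = _).symm.trans hy)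
  · intro x hx
    rw [hcyl x hx]
    exact measurableSet_forall_lt_eq j (f x)
end

section
/- Let n ≥ 1 be an integer and let (S_i)_{i ∈ {1,…,n}} be any DDG for the uniform distribution p i = 1/n on {1, …, n}. Then for every j ∈ ℕ, the number of flips N used satisfies P(N > j) ≥ (2^j mod n) / 2^j, i.e., 1 − ∑_{w ∈ S, |w| ≤ j} 2^{−|w|} ≥ (2^j mod n) / 2^j. -/
open scoped ENNReal NNReal

/-- A finite set of strings of length at most `j` has dyadic total weight with denominator
`2 ^ j`. -/
theorem sum_ddgWt_eq_natCast_div (j : ℕ) (A : Finset (List Bool)) (hA : ∀ w ∈ A, w.length ≤ j) :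
    ∑ w ∈ A, ddgWt w = ((∑ w ∈ A, 2 ^ (j - w.length) : ℕ) : ℝ≥0) / 2 ^ j := by
  rw [Nat.cast_sum, Finset.sum_div]
  refine Finset.sum_congr rfl fun w hw => ?_
  rw [ddgWt, eq_div_iff (by positivity), ← Nat.sub_add_cancel (hA w hw), pow_add]
  simp [mul_left_comm]

/-- A finite set of strings of length at most `j` and total weight at most `1 / n` has total
weight at most `⌊2 ^ j / n⌋ / 2 ^ j`. -/
theorem sum_ddgWt_le_natDiv_div {n : ℕ} (hn : 1 ≤ n) (j : ℕ) (A : Finset (List Bool))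
    (hA : ∀ w ∈ A, w.length ≤ j) (h : ∑ w ∈ A, ddgWt w ≤ (n : ℝ≥0)⁻¹) :
    ∑ w ∈ A, ddgWt w ≤ ((2 ^ j / n : ℕ) : ℝ≥0) / 2 ^ j := by
  rw [sum_ddgWt_eq_natCast_div j A hA] at h ⊢
  have hn' : (0 : ℝ≥0) < n := by exact_mod_cast hn
  rw [div_le_iff₀ (by positivity), inv_mul_eq_div, le_div_iff₀ hn'] at h
  gcongr
  rw [Nat.le_div_iff_mul_le hn]
  exact_mod_cast h

/-- Any DDG for the uniform distribution on `n` outcomes has, for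
every `j`, tail probability `P(N > j)` at least `(2^j mod n) / 2^j`. -/
theorem ddg_uniform_tail_lower_bound (n : ℕ) (hn : 1 ≤ n)
    (S : Fin n → Set (List Bool)) (hS : IsDDG (fun _ : Fin n => (n : ℝ≥0)⁻¹) S) :
    ∀ j : ℕ, ((2 ^ j % n : ℕ) : ℝ≥0) / (2 ^ j : ℝ≥0) ≤ ddgTail S j := by
  classical
  intro j
  have hn' : (0 : ℝ≥0) < n := by exact_mod_cast hn
  have hfin (i : Fin n) : {w ∈ S i | w.length ≤ j}.Finite :=
    (List.finite_length_le Bool j).subset fun w hw => hw.2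
  let A (i : Fin n) : Finset (List Bool) := (hfin i).toFinset
  have hA (i : Fin n) : ∑ w ∈ A i, ddgWt w ≤ ((2 ^ j / n : ℕ) : ℝ≥0) / 2 ^ j := by
    refine sum_ddgWt_le_natDiv_div hn j _ (fun w hw => ((hfin i).mem_toFinset.1 hw).2) ?_
    have hsum : Summable fun w : S i => ddgWt (w : List Bool) := by
      by_contra hns
      have := hS.mass i
      rw [tsum_eq_zero_of_not_summable hns] at this
      exact (inv_pos.2 hn').ne this
    have hsub : ∀ w ∈ A i, w ∈ S i := fun w hw => ((hfin i).mem_toFinset.1 hw).1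
    rw [← hS.mass i, ← Finset.sum_subtype_of_mem ddgWt hsub]
    exact hsum.sum_le_tsum _ fun _ _ => zero_le
  have hunion : {w ∈ ⋃ i, S i | w.length ≤ j} = (Finset.univ.biUnion A : Set (List Bool)) := by
    ext w
    simp [A]
  have hdisj : ((Finset.univ : Finset (Fin n)) : Set (Fin n)).PairwiseDisjoint A := by
    intro i _ k _ hik
    refine Finset.disjoint_left.2 fun w hi hk => ?_
    exact Set.disjoint_left.1 (hS.pairwise_disjoint hik) ((hfin i).mem_toFinset.1 hi).1
      ((hfin k).mem_toFinset.1 hk).1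
  have hle : ∑' w : ({w ∈ ⋃ i, S i | w.length ≤ j} : Set (List Bool)), ddgWt (w : List Bool)
      ≤ ((n * (2 ^ j / n) : ℕ) : ℝ≥0) / 2 ^ j := by
    rw [hunion, Finset.tsum_subtype' _ ddgWt, Finset.sum_biUnion hdisj]
    refine (Finset.sum_le_sum fun i _ => hA i).trans_eq ?_
    simp [mul_div_assoc]
  have hsplit : ((2 ^ j % n : ℕ) : ℝ≥0) / 2 ^ j + ((n * (2 ^ j / n) : ℕ) : ℝ≥0) / 2 ^ j = 1 := by
    rw [← add_div, ← Nat.cast_add, Nat.mod_add_div]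
    simp
  rw [ddgTail]
  exact le_tsub_of_add_le_right ((add_le_add_right hle _).trans_eq hsplit)
end

section
/- Fix an integer n ≥ 1. Each state of optimal_uniform(n) is reached by a unique set of flips: for every k ∈ ℕ and finite bit strings w, w' of length k, if running the step function from (1, 1) along w and along w' produces in each case intermediate states with second component < n at all steps before step k, and the two states after k steps are equal, then w = w'. -/
open MeasureTheory
open scoped ENNReal NNReal

/-- Running a finite bit string `w` from the initial state `(1, 1)`. -/
def kyRun (n : ℕ) (w : List Bool) : ℕ × ℕ :=
  w.foldl (kyStep n) (1, 1)

theorem kyStep_bounds {n : ℕ} {s : ℕ × ℕ} (h : 1 ≤ s.1 ∧ s.1 ≤ s.2 ∧ s.2 ≤ n) (B : Bool) :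
    1 ≤ (kyStep n s B).1 ∧ (kyStep n s B).1 ≤ (kyStep n s B).2 ∧ (kyStep n s B).2 ≤ n := by
  unfold kyStep
  cases B <;> grind

theorem kyStep_snd_of_lt {n : ℕ} {s : ℕ × ℕ} {B : Bool} (hs : s.2 < n)
    (h : (kyStep n s B).2 < n) :
    (kyStep n s B).2 = if n ≤ 2 * s.2 then 2 * s.2 - n else 2 * s.2 := by
  unfold kyStep at *
  grind

theorem kyStep_inj {n : ℕ} {s t : ℕ × ℕ} {B C : Bool} (hm : s.2 = t.2) (hn : s.2 < n)
    (hs : 1 ≤ s.1 ∧ s.1 ≤ s.2) (ht : 1 ≤ t.1 ∧ t.1 ≤ t.2)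
    (h : kyStep n s B = kyStep n t C) : s = t ∧ B = C := by
  obtain ⟨X, m⟩ := s
  obtain ⟨Y, m'⟩ := t
  unfold kyStep at h
  cases B <;> cases C <;> grind

theorem kyRun_append_singleton (n : ℕ) (w : List Bool) (B : Bool) :
    kyRun n (w ++ [B]) = kyStep n (kyRun n w) B := by
  simp [kyRun]

theorem kyRun_bounds {n : ℕ} (hn : 1 ≤ n) (w : List Bool) :
    1 ≤ (kyRun n w).1 ∧ (kyRun n w).1 ≤ (kyRun n w).2 ∧ (kyRun n w).2 ≤ n := by
  induction w using List.reverseRecOn with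
  | nil => simpa [kyRun] using hn
  | append_singleton w B ih =>
    rw [kyRun_append_singleton]
    exact kyStep_bounds ih B

theorem kyRun_take_succ (n : ℕ) {w : List Bool} {j : ℕ} (hj : j < w.length) :
    kyRun n (w.take (j + 1)) = kyStep n (kyRun n (w.take j)) w[j] := by
  rw [List.take_succ_eq_append_getElem hj, kyRun_append_singleton]

/-- Before termination, the second component depends only on the number of flips. -/
theorem kyRun_take_snd_eq {n k : ℕ} {w w' : List Bool} (hw : w.length = k) (hw' : w'.length = k)
    (hint : ∀ j < k, (kyRun n (w.take j)).2 < n)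
    (hint' : ∀ j < k, (kyRun n (w'.take j)).2 < n) :
    ∀ j < k, (kyRun n (w.take j)).2 = (kyRun n (w'.take j)).2 := by
  intro j
  induction j with
  | zero => simp
  | succ j ih =>
    intro hj
    have h := hint _ hj
    have h' := hint' _ hj
    rw [kyRun_take_succ n (by omega)] at h h' ⊢
    rw [kyRun_take_succ n (by omega), kyStep_snd_of_lt (hint j (by omega)) h,
      kyStep_snd_of_lt (hint' j (by omega)) h', ih (by omega)]

/-- Each state of `optimal_uniform n` is reached by a unique set of
flips: if two bit strings of length `k` both keep the second component of all
intermediate states (before step `k`) below `n`, and lead to the same state after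
`k` steps, then they are equal. -/
theorem optimal_uniform_unique_flips (n : ℕ) (hn : 1 ≤ n) (k : ℕ)
    (w w' : List Bool) (hw : w.length = k) (hw' : w'.length = k)
    (hint : ∀ j < k, (kyRun n (w.take j)).2 < n)
    (hint' : ∀ j < k, (kyRun n (w'.take j)).2 < n)
    (heq : kyRun n w = kyRun n w') : w = w' := by
  have hm := kyRun_take_snd_eq hw hw' hint hint'
  have key : ∀ j ≤ k, kyRun n (w.take j) = kyRun n (w'.take j) → w.take j = w'.take j := by
    intro j
    induction j with
    | zero => simp
    | succ j ih =>
      intro hj h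
      rw [kyRun_take_succ n (by omega), kyRun_take_succ n (by omega)] at h
      have hb := kyRun_bounds hn (w.take j)
      have hb' := kyRun_bounds hn (w'.take j)
      obtain ⟨hs, hB⟩ := kyStep_inj (hm j hj) (hint j hj) ⟨hb.1, hb.2.1⟩ ⟨hb'.1, hb'.2.1⟩ h
      rw [List.take_succ_eq_append_getElem (by omega),
        List.take_succ_eq_append_getElem (by omega), ih (by omega) hs, hB]
  have h := key k le_rfl
  rw [List.take_of_length_le hw.le, List.take_of_length_le hw'.le] at h
  exact h heq
end

section
/- Knuth–Yao lower bound for general distributions: let p be a probability mass function on a countable outcome set I and let (S_i)_{i ∈ I} be any DDG for p. Then for every j ∈ ℕ, the number of flips N used satisfies P(N > j) ≥ ∑_{i ∈ I} (2^j · p i − ⌊2^j · p i⌋) / 2^j; that is, 1 − ∑_{w ∈ S, |w| ≤ j} 2^{−|w|} ≥ 2^{−j} · ∑_{i ∈ I} (2^j p i − ⌊2^j p i⌋). -/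
open scoped ENNReal NNReal

theorem ddgWt_eq_of_length_le {w : List Bool} {j : ℕ} (hw : w.length ≤ j) :
    (2 : ℝ≥0) ^ j * ddgWt w = ((2 ^ (j - w.length) : ℕ) : ℝ≥0) := by
  have h : (2 : ℝ≥0) ^ j = 2 ^ (j - w.length) * 2 ^ w.length := by
    rw [← pow_add, Nat.sub_add_cancel hw]
  rw [ddgWt, h, mul_assoc, ← mul_pow]
  simp

/-- A set of bit strings of length at most `j` has a total weight in `2^{-j} ℕ`. -/
theorem exists_nat_eq_two_pow_mul_tsum_ddgWt (A : Set (List Bool)) (j : ℕ)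
    (hA : ∀ w ∈ A, w.length ≤ j) :
    ∃ n : ℕ, (2 : ℝ≥0) ^ j * ∑' w : A, ddgWt (w : List Bool) = n := by
  have hfin : A.Finite := (List.finite_length_le Bool j).subset hA
  have : Fintype A := hfin.fintype
  refine ⟨∑ w : A, 2 ^ (j - (w : List Bool).length), ?_⟩
  rw [tsum_fintype, Finset.mul_sum, Nat.cast_sum]
  exact Finset.sum_congr rfl fun w _ => ddgWt_eq_of_length_le (hA w w.2)

theorem NNReal.inv_mul_sub_floor_add_le {c p q : ℝ≥0} (hc : c ≠ 0) (hqp : q ≤ p)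
    (hq : ∃ n : ℕ, c * q = n) : c⁻¹ * (c * p - (⌊c * p⌋₊ : ℝ≥0)) + q ≤ p := by
  obtain ⟨n, hn⟩ := hq
  have hle : c * q ≤ (⌊c * p⌋₊ : ℝ≥0) := by
    rw [hn, Nat.cast_le]
    exact Nat.le_floor (hn ▸ mul_le_mul_right hqp c)
  calc c⁻¹ * (c * p - (⌊c * p⌋₊ : ℝ≥0)) + q
      = c⁻¹ * (c * p - (⌊c * p⌋₊ : ℝ≥0) + c * q) := by
        rw [mul_add, inv_mul_cancel_left₀ hc]
    _ ≤ c⁻¹ * (c * p) := by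
        gcongr
        exact (add_le_add_right hle _).trans_eq
          (tsub_add_cancel_of_le (Nat.floor_le zero_le))
    _ = p := inv_mul_cancel_left₀ hc p

theorem IsDDG.summable_ddgWt {I : Type*} {p : I → ℝ≥0} {S : I → Set (List Bool)}
    (hS : IsDDG p S) {A : Set (List Bool)} (hA : A ⊆ ⋃ i, S i) :
    Summable fun w : A => ddgWt (w : List Bool) := by
  have h : Summable fun w : (⋃ i, S i : Set (List Bool)) => ddgWt (w : List Bool) := by
    by_contra h
    exact zero_ne_one ((tsum_eq_zero_of_not_summable h).symm.trans hS.total)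
  have hcomp := NNReal.summable_comp_injective h (Set.inclusion_injective hA)
  exact hcomp

/-- The strings of length at most `j` in `S i` have total weight at most `p i`. -/
theorem IsDDG.tsum_length_le_le {I : Type*} {p : I → ℝ≥0} {S : I → Set (List Bool)}
    (hS : IsDDG p S) (j : ℕ) (i : I) :
    ∑' w : ({w ∈ S i | w.length ≤ j} : Set (List Bool)), ddgWt (w : List Bool) ≤ p i := by
  rw [← hS.mass i]
  have hsub : ({w ∈ S i | w.length ≤ j} : Set (List Bool)) ⊆ S i := Set.sep_subset _ _
  exact Summable.tsum_le_tsum_of_inj (Set.inclusion hsub) (Set.inclusion_injective hsub)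
    (fun _ _ => zero_le) (fun _ => le_rfl)
    (hS.summable_ddgWt (hsub.trans (Set.subset_iUnion S i)))
    (hS.summable_ddgWt (Set.subset_iUnion S i))

/-- Knuth–Yao lower bound for general distributions. For any DDG
for a probability mass function `p` on a countable outcome set and any `j`, the tail
probability `P(N > j)` is at least `2^{-j} ∑_i (2^j p i − ⌊2^j p i⌋)`. -/
theorem ddg_tail_lower_bound {I : Type*} [Countable I]
    (p : I → ℝ≥0) (hp : ∑' i, p i = 1)
    (S : I → Set (List Bool)) (hS : IsDDG p S) (j : ℕ) :
    ((2 : ℝ≥0) ^ j)⁻¹ *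
        ∑' i : I, ((2 : ℝ≥0) ^ j * p i - (⌊(2 : ℝ≥0) ^ j * p i⌋₊ : ℝ≥0))
      ≤ ddgTail S j := by
  have hp_summable : Summable p := by
    by_contra h
    simp [tsum_eq_zero_of_not_summable h] at hp
  let f : I → ℝ≥0 := fun i => (2 : ℝ≥0) ^ j * p i - (⌊(2 : ℝ≥0) ^ j * p i⌋₊ : ℝ≥0)
  let T : I → Set (List Bool) := fun i => {w ∈ S i | w.length ≤ j}
  let q : I → ℝ≥0 := fun i => ∑' w : T i, ddgWt (w : List Bool)
  have hTS : ∀ i, T i ⊆ ⋃ i, S i := fun i =>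
    (Set.sep_subset _ _).trans (Set.subset_iUnion S i)
  have hT : ({w ∈ ⋃ i, S i | w.length ≤ j} : Set (List Bool)) = ⋃ i, T i := by
    ext w
    simp [T]
  have hpt : ∀ i, ((2 : ℝ≥0) ^ j)⁻¹ * f i + q i ≤ p i := fun i =>
    NNReal.inv_mul_sub_floor_add_le (by positivity) (hS.tsum_length_le_le j i)
      (exists_nat_eq_two_pow_mul_tsum_ddgWt (T i) j fun _ hw => hw.2)
  have hf : Summable fun i => ((2 : ℝ≥0) ^ j)⁻¹ * f i :=
    NNReal.summable_of_le (fun i => le_self_add.trans (hpt i)) hp_summable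
  have hq : Summable q :=
    NNReal.summable_of_le (fun i => le_add_self.trans (hpt i)) hp_summable
  have hQ : ∑' w : (⋃ i, T i : Set (List Bool)), ddgWt (w : List Bool) ≤ ∑' i, q i := by
    rw [← ENNReal.coe_le_coe, ENNReal.coe_tsum hq,
      ENNReal.coe_tsum (hS.summable_ddgWt (Set.iUnion_subset hTS))]
    refine (ENNReal.tsum_iUnion_le_tsum (fun w => (ddgWt w : ℝ≥0∞)) T).trans_eq ?_
    exact tsum_congr fun i => (ENNReal.coe_tsum (hS.summable_ddgWt (hTS i))).symm
  rw [ddgTail, hT]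
  refine le_tsub_of_add_le_right ?_
  calc _ ≤ ∑' i, ((2 : ℝ≥0) ^ j)⁻¹ * f i + ∑' i, q i := by
        rw [NNReal.tsum_mul_left]
        exact add_le_add_right hQ _
    _ = ∑' i, (((2 : ℝ≥0) ^ j)⁻¹ * f i + q i) := (hf.tsum_add hq).symm
    _ ≤ ∑' i, p i := (hf.add hq).tsum_le_tsum hpt hp_summable
    _ = 1 := hp
end

section
/- Let n ≥ 1 be an integer and let (S_i)_{i ∈ {1,…,n}} be any DDG for the uniform distribution p i = 1/n on {1, …, n}. Then every bit string w in the union S = ⋃_i S_i has length |w| ≥ ⌈log₂ n⌉; consequently, any DDG for a fair n-sided die uses at least ⌈log₂ n⌉ flips with probability 1. -/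
open scoped ENNReal NNReal

/-- In any DDG for the uniform distribution on `n` outcomes, every
bit string has length at least `⌈log₂ n⌉`; i.e., a DDG for a fair `n`-sided die uses
at least `⌈log₂ n⌉` flips with probability 1. -/
theorem ddg_uniform_min_flips (n : ℕ) (hn : 1 ≤ n)
    (S : Fin n → Set (List Bool)) (hS : IsDDG (fun _ : Fin n => (n : ℝ≥0)⁻¹) S) :
    ∀ w ∈ ⋃ i, S i, Nat.clog 2 n ≤ w.length := by
  intro w hw
  obtain ⟨i, hi⟩ := Set.mem_iUnion.mp hw
  have hn0 : (0 : ℝ≥0) < n := by exact_mod_cast hn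
  have hsum : Summable fun v : S i => ddgWt (v : List Bool) := by
    by_contra h
    have hm := hS.mass i
    rw [tsum_eq_zero_of_not_summable h] at hm
    exact (inv_pos.mpr hn0).ne hm
  have hle : ddgWt w ≤ (n : ℝ≥0)⁻¹ :=
    (hsum.le_tsum ⟨w, hi⟩ fun _ _ => zero_le).trans_eq (hS.mass i)
  rw [ddgWt, inv_pow, inv_le_inv₀ (by positivity) hn0] at hle
  exact Nat.clog_le_of_le_pow (by exact_mod_cast hle)
end
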